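/- Let ρ be a bipartite density matrix on nA × nB, and let Λ be a quantum channel acting only on B, given in Kraus form by matrices M j : Matrix nB nB ℂ with ∑ j, (M j)∗ · (M j) = 1, acting as Λ(ρ) = ∑ j, (1 ⊗ M j) ρ (1 ⊗ M j)∗. Then the quantum-incoherent relative entropy does not increase: C^{A|B}(Λ(ρ)) ≤ C^{A|B}(ρ). -/

import Mathlib

open Matrix
open Kronecker
open scoped ComplexOrder

/-- Von Neumann entropy of a matrix (defined via its eigenvalues when it is Hermitian). -/
noncomputable def vN {n : Type*} [Fintype n] [DecidableEq n] (ρ : Matrix n n ℂ) : ℝ :=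
  letI := Classical.propDecidable ρ.IsHermitian
  if h : ρ.IsHermitian then ∑ i, Real.negMulLog (h.eigenvalues i) else 0

/-- Full dephasing in the standard basis. -/
noncomputable def deph {n : Type*} [Fintype n] [DecidableEq n] (ρ : Matrix n n ℂ) :
    Matrix n n ℂ := Matrix.diagonal fun i => ρ i i

/-- Relative entropy of coherence in the standard basis. -/
noncomputable def coh {n : Type*} [Fintype n] [DecidableEq n] (ρ : Matrix n n ℂ) : ℝ :=
  vN (deph ρ) - vN ρ

/-- Partial dephasing on the first (A) subsystem of a bipartite state. -/
noncomputable def dephA {nA nB : Type*} [Fintype nA] [DecidableEq nA]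
    [Fintype nB] [DecidableEq nB] (ρ : Matrix (nA × nB) (nA × nB) ℂ) :
    Matrix (nA × nB) (nA × nB) ℂ :=
  Matrix.of fun p q => if p.1 = q.1 then ρ p q else 0

/-- Reduced state on subsystem A. -/
noncomputable def redA {nA nB : Type*} [Fintype nA] [DecidableEq nA]
    [Fintype nB] [DecidableEq nB] (ρ : Matrix (nA × nB) (nA × nB) ℂ) : Matrix nA nA ℂ :=
  Matrix.of fun a a' => ∑ b, ρ (a, b) (a', b)

/-- Reduced state on subsystem B. -/
noncomputable def redB {nA nB : Type*} [Fintype nA] [DecidableEq nA]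
    [Fintype nB] [DecidableEq nB] (ρ : Matrix (nA × nB) (nA × nB) ℂ) : Matrix nB nB ℂ :=
  Matrix.of fun b b' => ∑ a, ρ (a, b) (a, b')

/-- Quantum mutual information of a bipartite state. -/
noncomputable def mi {nA nB : Type*} [Fintype nA] [DecidableEq nA]
    [Fintype nB] [DecidableEq nB] (ρ : Matrix (nA × nB) (nA × nB) ℂ) : ℝ :=
  vN (redA ρ) + vN (redB ρ) - vN ρ

/-- The action `(U ⊗ 1) ρ (U ⊗ 1)∗` of a local unitary on the A subsystem. -/
noncomputable def conjA {nA nB : Type*} [Fintype nA] [DecidableEq nA]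
    [Fintype nB] [DecidableEq nB] (U : Matrix nA nA ℂ)
    (ρ : Matrix (nA × nB) (nA × nB) ℂ) : Matrix (nA × nB) (nA × nB) ℂ :=
  (U ⊗ₖ (1 : Matrix nB nB ℂ)) * ρ * (U ⊗ₖ (1 : Matrix nB nB ℂ))ᴴ

section RelativeEntropy

variable {n : Type*} [Fintype n] [DecidableEq n]

/-- The unitary `U` diagonalizes `A`, with real eigenvalues `a`. -/
def Diagonalizes (U : Matrix n n ℂ) (a : n → ℝ) (A : Matrix n n ℂ) : Prop :=
  Uᴴ * U = 1 ∧ U * Uᴴ = 1 ∧ A = U * diagonal (fun i => (a i : ℂ)) * Uᴴ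

/-- The transition probability between the `j`-th column of `V` and the `i`-th column of `U`. -/
noncomputable def overlap (V U : Matrix n n ℂ) (j i : n) : ℝ := Complex.normSq ((Vᴴ * U) j i)

/-- The concave quadratic form in `X` whose maximum is
`⟪ρ, (L_σ + t R_ρ)⁻¹ ρ⟫`, where `L_σ` and `R_ρ` are left and right multiplication. -/
noncomputable def variationalForm (t : ℝ) (ρ σ X : Matrix n n ℂ) : ℝ :=
  2 * (Xᴴ * ρ).trace.re - (Xᴴ * σ * X).trace.re - t * (X * ρ * Xᴴ).trace.re

lemma Matrix.IsHermitian.diagonalizes {A : Matrix n n ℂ} (hA : A.IsHermitian) :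
    Diagonalizes (hA.eigenvectorUnitary : Matrix n n ℂ) hA.eigenvalues A := by
  refine ⟨?_, ?_, ?_⟩
  · exact Unitary.coe_star_mul_self hA.eigenvectorUnitary
  · exact Unitary.coe_mul_star_self hA.eigenvectorUnitary
  · have h := hA.spectral_theorem
    rw [Unitary.conjStarAlgAut_apply] at h
    exact h

lemma trace_diagonal_form (q : n → ℝ) (Y : Matrix n n ℂ) :
    (Yᴴ * diagonal (fun i => (q i : ℂ)) * Y).trace.re
      = ∑ j, ∑ i, q j * Complex.normSq (Y j i) := by
  rw [Finset.sum_comm]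
  simp only [trace, diag_apply, mul_apply (M := _ * diagonal _), mul_diagonal, Complex.re_sum]
  refine Finset.sum_congr rfl fun i _ => Finset.sum_congr rfl fun j _ => ?_
  simp [conjTranspose_apply, Complex.normSq_apply]
  ring

lemma trace_diagonal_form' (p : n → ℝ) (Y : Matrix n n ℂ) :
    (Y * diagonal (fun i => (p i : ℂ)) * Yᴴ).trace.re
      = ∑ j, ∑ i, p i * Complex.normSq (Y j i) := by
  have h := trace_diagonal_form p Yᴴ
  rw [conjTranspose_conjTranspose] at h
  rw [h, Finset.sum_comm]
  simp [conjTranspose_apply, Complex.normSq_apply]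

lemma variationalForm_eq {U V ρ σ : Matrix n n ℂ} {p q : n → ℝ}
    (hρ : Diagonalizes U p ρ) (hσ : Diagonalizes V q σ) (t : ℝ) (Y : Matrix n n ℂ) :
    variationalForm t ρ σ (V * Y * Uᴴ) = ∑ j, ∑ i,
      (2 * ((star (Y j i) * (Vᴴ * U) j i).re * p i)
        - (q j + t * p i) * Complex.normSq (Y j i)) := by
  obtain ⟨hU, hU', rfl⟩ := hρ
  obtain ⟨hV, hV', rfl⟩ := hσ
  set P := diagonal fun i => (p i : ℂ) with hP
  set Q := diagonal fun i => (q i : ℂ) with hQ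
  have h₁ : ((V * Y * Uᴴ)ᴴ * (U * P * Uᴴ)).trace = (Yᴴ * (Vᴴ * U * P)).trace := by
    rw [conjTranspose_mul, conjTranspose_mul, conjTranspose_conjTranspose, trace_mul_comm,
      show U * P * Uᴴ * (U * (Yᴴ * Vᴴ)) = U * P * (Uᴴ * U) * Yᴴ * Vᴴ by
        simp only [Matrix.mul_assoc], hU, Matrix.mul_one, trace_mul_comm, trace_mul_comm Yᴴ]
    simp only [Matrix.mul_assoc]
  have h₂ : ((V * Y * Uᴴ)ᴴ * (V * Q * Vᴴ) * (V * Y * Uᴴ)).trace = (Yᴴ * Q * Y).trace := by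
    rw [conjTranspose_mul, conjTranspose_mul, conjTranspose_conjTranspose,
      show U * (Yᴴ * Vᴴ) * (V * Q * Vᴴ) * (V * Y * Uᴴ)
        = U * (Yᴴ * (Vᴴ * V) * Q * (Vᴴ * V) * Y * Uᴴ) by
        simp only [Matrix.mul_assoc], hV, trace_mul_comm]
    simp only [Matrix.mul_assoc, hU, Matrix.mul_one]
  have h₃ : ((V * Y * Uᴴ) * (U * P * Uᴴ) * (V * Y * Uᴴ)ᴴ).trace = (Y * P * Yᴴ).trace := by
    rw [conjTranspose_mul, conjTranspose_mul, conjTranspose_conjTranspose,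
      show V * Y * Uᴴ * (U * P * Uᴴ) * (U * (Yᴴ * Vᴴ))
        = V * (Y * (Uᴴ * U) * P * (Uᴴ * U) * Yᴴ * Vᴴ) by
        simp only [Matrix.mul_assoc], hU, trace_mul_comm]
    simp only [Matrix.mul_assoc, hV, Matrix.mul_one]
  have h₄ : (Yᴴ * (Vᴴ * U * P)).trace.re
      = ∑ j, ∑ i, (star (Y j i) * (Vᴴ * U) j i).re * p i := by
    rw [Finset.sum_comm]
    rw [trace, Complex.re_sum]
    refine Finset.sum_congr rfl fun i _ => ?_
    rw [diag_apply, mul_apply, Complex.re_sum]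
    refine Finset.sum_congr rfl fun j _ => ?_
    rw [hP, mul_diagonal, ← mul_assoc, Complex.re_mul_ofReal, conjTranspose_apply]
  rw [variationalForm, h₁, h₂, h₃, h₄, trace_diagonal_form, trace_diagonal_form']
  simp only [Finset.mul_sum, ← Finset.sum_sub_distrib]
  refine Finset.sum_congr rfl fun j _ => Finset.sum_congr rfl fun i _ => ?_
  ring

lemma two_mul_re_sub_le (y w : ℂ) {p c : ℝ} (hc : 0 ≤ c) (h0 : c = 0 → w = 0 ∨ p = 0) :
    2 * ((star y * w).re * p) - c * Complex.normSq y ≤ Complex.normSq w * (p ^ 2 / c) := by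
  rcases hc.eq_or_lt with rfl | hc
  · rcases h0 rfl with rfl | rfl <;> simp
  · rw [← mul_div_assoc, le_div_iff₀ hc]
    simp only [Complex.star_def, Complex.mul_re, Complex.conj_re, Complex.conj_im,
      Complex.normSq_apply]
    nlinarith [sq_nonneg (c * y.re - p * w.re), sq_nonneg (c * y.im - p * w.im)]

lemma two_mul_re_sub_eq (w : ℂ) (p c : ℝ) :
    2 * ((star (w * ((p / c : ℝ) : ℂ)) * w).re * p)
      - c * Complex.normSq (w * ((p / c : ℝ) : ℂ)) = Complex.normSq w * (p ^ 2 / c) := by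
  rcases eq_or_ne c 0 with rfl | hc
  · simp
  · simp only [Complex.star_def, map_mul, Complex.conj_ofReal, Complex.normSq_ofReal]
    rw [mul_right_comm, Complex.re_mul_ofReal, mul_comm (starRingEnd ℂ w), Complex.mul_conj,
      Complex.ofReal_re]
    field_simp
    ring

/-- The kernel condition in terms of eigenvalues and overlaps. -/
lemma overlap_eq_zero {U V ρ σ : Matrix n n ℂ} {p q : n → ℝ}
    (hρ : Diagonalizes U p ρ) (hσ : Diagonalizes V q σ)
    (hker : ∀ x, σ *ᵥ x = 0 → ρ *ᵥ x = 0) {j : n} (hj : q j = 0) (i : n) :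
    (Vᴴ * U) j i = 0 ∨ p i = 0 := by
  obtain ⟨hU, hU', hρ⟩ := hρ
  obtain ⟨hV, hV', hσ⟩ := hσ
  have hσv : σ *ᵥ (V *ᵥ Pi.single j 1) = 0 := by
    rw [mulVec_mulVec, hσ, Matrix.mul_assoc, hV, Matrix.mul_one, ← mulVec_mulVec]
    have : diagonal (fun i => (q i : ℂ)) *ᵥ Pi.single j 1 = 0 := by
      ext k
      rcases eq_or_ne k j with rfl | hk <;> simp [mulVec_diagonal, *]
    rw [this, mulVec_zero]
  have hρv := congrArg (Uᴴ *ᵥ ·) (hker _ hσv)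
  simp only [mulVec_mulVec, mulVec_zero] at hρv
  have h : Uᴴ * (ρ * V) = diagonal (fun i => (p i : ℂ)) * (Uᴴ * V) := by
    rw [hρ, show Uᴴ * (U * diagonal (fun i => (p i : ℂ)) * Uᴴ * V)
      = (Uᴴ * U) * (diagonal (fun i => (p i : ℂ)) * (Uᴴ * V)) by
      simp only [Matrix.mul_assoc], hU, Matrix.one_mul]
  have hi := congrFun hρv i
  rw [h, mulVec_single_one, col_apply, diagonal_mul, Pi.zero_apply, mul_eq_zero] at hi
  rcases hi with hi | hi
  · exact Or.inr (by exact_mod_cast hi)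
  · left
    rw [← conjTranspose_conjTranspose U, ← conjTranspose_mul, conjTranspose_apply, hi, star_zero]

lemma variationalForm_le {U V ρ σ : Matrix n n ℂ} {p q : n → ℝ}
    (hρ : Diagonalizes U p ρ) (hσ : Diagonalizes V q σ) (hp : 0 ≤ p) (hq : 0 ≤ q)
    (hker : ∀ x, σ *ᵥ x = 0 → ρ *ᵥ x = 0) {t : ℝ} (ht : 0 < t) (X : Matrix n n ℂ) :
    variationalForm t ρ σ X ≤ ∑ j, ∑ i, overlap V U j i * (p i ^ 2 / (q j + t * p i)) := by
  have hX : X = V * (Vᴴ * X * U) * Uᴴ := by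
    rw [show V * (Vᴴ * X * U) * Uᴴ = (V * Vᴴ) * X * (U * Uᴴ) by simp only [Matrix.mul_assoc],
      hσ.2.1, hρ.2.1, Matrix.one_mul, Matrix.mul_one]
  rw [hX, variationalForm_eq hρ hσ]
  refine Finset.sum_le_sum fun j _ => Finset.sum_le_sum fun i _ =>
    two_mul_re_sub_le _ _ (add_nonneg (hq j) (mul_nonneg ht.le (hp i))) fun h => ?_
  have := hq j
  have := mul_nonneg ht.le (hp i)
  simp only [Pi.zero_apply] at *
  exact overlap_eq_zero hρ hσ hker (by linarith) i

lemma exists_variationalForm_eq {U V ρ σ : Matrix n n ℂ} {p q : n → ℝ}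
    (hρ : Diagonalizes U p ρ) (hσ : Diagonalizes V q σ) (t : ℝ) :
    ∃ X, variationalForm t ρ σ X
      = ∑ j, ∑ i, overlap V U j i * (p i ^ 2 / (q j + t * p i)) := by
  refine ⟨V * (of fun j i => (Vᴴ * U) j i * ((p i / (q j + t * p i) : ℝ) : ℂ)) * Uᴴ, ?_⟩
  rw [variationalForm_eq hρ hσ]
  refine Finset.sum_congr rfl fun j _ => Finset.sum_congr rfl fun i _ => ?_
  exact two_mul_re_sub_eq _ _ _

section Channel

variable {ι : Type*} [Fintype ι]

/-- Kadison's inequality for the adjoint of a channel in Kraus form, under a trace. -/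
lemma trace_adjoint_channel_le {K : ι → Matrix n n ℂ} (hK : ∑ j, (K j)ᴴ * K j = 1)
    {σ : Matrix n n ℂ} (hσ : σ.PosSemidef) (Y : Matrix n n ℂ) :
    ((∑ j, (K j)ᴴ * Y * K j)ᴴ * σ * (∑ j, (K j)ᴴ * Y * K j)).trace.re
      ≤ (Yᴴ * (∑ j, K j * σ * (K j)ᴴ) * Y).trace.re := by
  set X := ∑ j, (K j)ᴴ * Y * K j with hX
  have hX' : Xᴴ = ∑ j, (K j)ᴴ * Yᴴ * K j := by
    simp only [hX, conjTranspose_sum, conjTranspose_mul, conjTranspose_conjTranspose,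
      Matrix.mul_assoc]
  have hpos : 0 ≤ (∑ j, (Yᴴ * K j - K j * Xᴴ) * σ * (Yᴴ * K j - K j * Xᴴ)ᴴ).trace := by
    rw [trace_sum]
    exact Finset.sum_nonneg fun j _ => (hσ.mul_mul_conjTranspose_same _).trace_nonneg
  have hexp : (∑ j, (Yᴴ * K j - K j * Xᴴ) * σ * (Yᴴ * K j - K j * Xᴴ)ᴴ).trace
      = (Yᴴ * (∑ j, K j * σ * (K j)ᴴ) * Y).trace - (Xᴴ * σ * X).trace := by
    have e₁ : ∀ j, ((Yᴴ * K j - K j * Xᴴ) * σ * (Yᴴ * K j - K j * Xᴴ)ᴴ).trace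
        = (Yᴴ * (K j * σ * (K j)ᴴ) * Y).trace - (((K j)ᴴ * Yᴴ * K j) * (σ * X)).trace
          - ((Xᴴ * σ) * ((K j)ᴴ * Y * K j)).trace
          + (Xᴴ * σ * X * ((K j)ᴴ * K j)).trace := by
      intro j
      simp only [conjTranspose_sub, conjTranspose_mul, conjTranspose_conjTranspose,
        Matrix.sub_mul, Matrix.mul_sub, trace_sub]
      have c₁ : (Yᴴ * K j * σ * (X * (K j)ᴴ)).trace
          = (((K j)ᴴ * Yᴴ * K j) * (σ * X)).trace := by
        rw [← Matrix.mul_assoc, trace_mul_comm]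
        simp only [Matrix.mul_assoc]
      have c₂ : (K j * Xᴴ * σ * ((K j)ᴴ * Y)).trace
          = ((Xᴴ * σ) * ((K j)ᴴ * Y * K j)).trace := by
        rw [Matrix.mul_assoc, Matrix.mul_assoc, trace_mul_comm]
        simp only [Matrix.mul_assoc]
      have c₃ : (K j * Xᴴ * σ * (X * (K j)ᴴ)).trace
          = (Xᴴ * σ * X * ((K j)ᴴ * K j)).trace := by
        rw [Matrix.mul_assoc, Matrix.mul_assoc, trace_mul_comm]
        simp only [Matrix.mul_assoc]
      rw [c₁, c₂, c₃]
      simp only [Matrix.mul_assoc]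
      ring
    rw [trace_sum, Finset.sum_congr rfl fun j _ => e₁ j]
    simp only [Finset.sum_add_distrib, Finset.sum_sub_distrib, ← trace_sum, ← Matrix.mul_sum,
      ← Matrix.sum_mul]
    rw [← hX', ← hX, hK, Matrix.mul_one, Matrix.mul_assoc Xᴴ σ X]
    ring
  rw [hexp] at hpos
  have := (Complex.le_def.1 hpos).1
  simp only [Complex.zero_re, Complex.sub_re] at this
  linarith

lemma exists_variationalForm_channel_le {K : ι → Matrix n n ℂ} (hK : ∑ j, (K j)ᴴ * K j = 1)
    {ρ σ : Matrix n n ℂ} (hρ : ρ.PosSemidef) (hσ : σ.PosSemidef) {t : ℝ} (ht : 0 ≤ t)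
    (Y : Matrix n n ℂ) :
    ∃ X, variationalForm t (∑ j, K j * ρ * (K j)ᴴ) (∑ j, K j * σ * (K j)ᴴ) Y
      ≤ variationalForm t ρ σ X := by
  refine ⟨∑ j, (K j)ᴴ * Y * K j, ?_⟩
  have hadj : (∑ j, (K j)ᴴ * Y * K j)ᴴ = ∑ j, (K j)ᴴ * Yᴴ * K j := by
    simp only [conjTranspose_sum, conjTranspose_mul, conjTranspose_conjTranspose,
      Matrix.mul_assoc]
  have h₁ : (Yᴴ * ∑ j, K j * ρ * (K j)ᴴ).trace
      = ((∑ j, (K j)ᴴ * Y * K j)ᴴ * ρ).trace := by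
    rw [hadj, Matrix.mul_sum, Matrix.sum_mul, trace_sum, trace_sum]
    refine Finset.sum_congr rfl fun j _ => ?_
    rw [← Matrix.mul_assoc, trace_mul_comm]
    simp only [Matrix.mul_assoc]
  have h₂ := trace_adjoint_channel_le hK hσ Y
  have h₃ := trace_adjoint_channel_le hK hρ Yᴴ
  rw [← hadj, conjTranspose_conjTranspose, conjTranspose_conjTranspose] at h₃
  have := mul_le_mul_of_nonneg_left h₃ ht
  rw [variationalForm, variationalForm, h₁]
  linarith

end Channel

/-- The integral over `[0, T]` of `p ^ 2 / (q + t * p)`, weighted by the overlaps. -/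
noncomputable def integratedForm (U V : Matrix n n ℂ) (p q : n → ℝ) (T : ℝ) : ℝ :=
  ∑ j, ∑ i, overlap V U j i * (p i * (Real.log (q j + T * p i) - Real.log (q j)))

lemma overlap_cases {U V ρ σ : Matrix n n ℂ} {p q : n → ℝ}
    (hρ : Diagonalizes U p ρ) (hσ : Diagonalizes V q σ) (hp : 0 ≤ p) (hq : 0 ≤ q)
    (hker : ∀ x, σ *ᵥ x = 0 → ρ *ᵥ x = 0) (j i : n) :
    overlap V U j i = 0 ∨ p i = 0 ∨ (0 < p i ∧ 0 < q j) := by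
  rcases (hp i).eq_or_lt with h | h
  · exact Or.inr (Or.inl h.symm)
  rcases (hq j).eq_or_lt with h' | h'
  · rcases overlap_eq_zero hρ hσ hker h'.symm i with h'' | h''
    · exact Or.inl (by rw [overlap, h'', map_zero])
    · exact Or.inr (Or.inl h'')
  · exact Or.inr (Or.inr ⟨h, h'⟩)

lemma hasDerivAt_integratedForm {U V ρ σ : Matrix n n ℂ} {p q : n → ℝ}
    (hρ : Diagonalizes U p ρ) (hσ : Diagonalizes V q σ) (hp : 0 ≤ p) (hq : 0 ≤ q)
    (hker : ∀ x, σ *ᵥ x = 0 → ρ *ᵥ x = 0) {T : ℝ} (hT : 0 ≤ T) :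
    HasDerivAt (integratedForm U V p q)
      (∑ j, ∑ i, overlap V U j i * (p i ^ 2 / (q j + T * p i))) T := by
  unfold integratedForm
  refine HasDerivAt.fun_sum fun j _ => HasDerivAt.fun_sum fun i _ => ?_
  rcases overlap_cases hρ hσ hp hq hker j i with h | h | ⟨h, h'⟩
  · simpa [h] using hasDerivAt_const T (0 : ℝ)
  · simpa [h] using hasDerivAt_const T (0 : ℝ)
  · have hpos : q j + T * p i ≠ 0 := by positivity
    have := (((((hasDerivAt_id T).mul_const (p i)).const_add (q j)).log hpos).sub_const
      (Real.log (q j))).const_mul (p i) |>.const_mul (overlap V U j i)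
    refine this.congr_deriv ?_
    simp only [id_eq]
    ring

lemma tendsto_integratedForm {U V ρ σ : Matrix n n ℂ} {p q : n → ℝ}
    (hρ : Diagonalizes U p ρ) (hσ : Diagonalizes V q σ) (hp : 0 ≤ p) (hq : 0 ≤ q)
    (hker : ∀ x, σ *ᵥ x = 0 → ρ *ᵥ x = 0) :
    Filter.Tendsto
      (fun T => integratedForm U V p q T - (∑ j, ∑ i, overlap V U j i * p i) * Real.log T)
      Filter.atTop
      (nhds (∑ j, ∑ i, overlap V U j i * (p i * (Real.log (p i) - Real.log (q j))))) := by
  simp only [integratedForm, Finset.sum_mul, ← Finset.sum_sub_distrib]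
  refine tendsto_finsetSum _ fun j _ => tendsto_finsetSum _ fun i _ => ?_
  rcases overlap_cases hρ hσ hp hq hker j i with h | h | ⟨h, h'⟩
  · simp [h]
  · simp [h]
  · have hlim : Filter.Tendsto (fun T : ℝ => q j * T⁻¹ + p i) Filter.atTop (nhds (p i)) := by
      simpa using (tendsto_inv_atTop_zero.const_mul (q j)).add_const (p i)
    have hlog := (((hlim.log h.ne').sub_const (Real.log (q j))).const_mul (p i)).const_mul
      (overlap V U j i)
    refine hlog.congr' ?_
    filter_upwards [Filter.eventually_gt_atTop 0] with T hT
    have : q j * T⁻¹ + p i = (q j + T * p i) / T := by field_simp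
    rw [this, Real.log_div (by positivity) hT.ne']
    ring

lemma sum_overlap {U V : Matrix n n ℂ} (hU : Uᴴ * U = 1) (hV : V * Vᴴ = 1) (i : n) :
    ∑ j, overlap V U j i = 1 := by
  have h : (Vᴴ * U)ᴴ * (Vᴴ * U) = 1 := by
    rw [conjTranspose_mul, conjTranspose_conjTranspose, Matrix.mul_assoc, ← Matrix.mul_assoc V,
      hV, Matrix.one_mul, hU]
  have hi := congrArg Complex.re (congrFun (congrFun h i) i)
  rw [mul_apply, one_apply_eq, Complex.one_re, Complex.re_sum] at hi
  rw [← hi]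
  refine Finset.sum_congr rfl fun j _ => ?_
  simp [overlap, Complex.normSq_apply]

lemma sum_overlap_mul {U V : Matrix n n ℂ} (hU : Uᴴ * U = 1) (hV : V * Vᴴ = 1) (f : n → ℝ) :
    ∑ j, ∑ i, overlap V U j i * f i = ∑ i, f i := by
  rw [Finset.sum_comm]
  simp only [← Finset.sum_mul, sum_overlap hU hV, one_mul]

lemma Diagonalizes.sum_eq_trace {U ρ : Matrix n n ℂ} {p : n → ℝ} (hρ : Diagonalizes U p ρ) :
    ∑ i, p i = ρ.trace.re := by
  rw [hρ.2.2, trace_mul_comm, ← Matrix.mul_assoc, hρ.1, Matrix.one_mul, trace_diagonal]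
  simp

/-- **Data processing inequality** for the relative entropy, written in eigenbases. -/
theorem relativeEntropy_channel_le {ι : Type*} [Fintype ι]
    {K : ι → Matrix n n ℂ} (hK : ∑ j, (K j)ᴴ * K j = 1)
    {ρ σ : Matrix n n ℂ} (hρ : ρ.PosSemidef) (hσ : σ.PosSemidef)
    (hker : ∀ x, σ *ᵥ x = 0 → ρ *ᵥ x = 0)
    (hker' : ∀ x, (∑ j, K j * σ * (K j)ᴴ) *ᵥ x = 0 → (∑ j, K j * ρ * (K j)ᴴ) *ᵥ x = 0)
    {U V U' V' : Matrix n n ℂ} {p q p' q' : n → ℝ}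
    (hU : Diagonalizes U p ρ) (hV : Diagonalizes V q σ)
    (hU' : Diagonalizes U' p' (∑ j, K j * ρ * (K j)ᴴ))
    (hV' : Diagonalizes V' q' (∑ j, K j * σ * (K j)ᴴ))
    (hp : 0 ≤ p) (hq : 0 ≤ q) (hp' : 0 ≤ p') (hq' : 0 ≤ q') :
    ∑ j, ∑ i, overlap V' U' j i * (p' i * (Real.log (p' i) - Real.log (q' j)))
      ≤ ∑ j, ∑ i, overlap V U j i * (p i * (Real.log (p i) - Real.log (q j))) := by
  have hanti : AntitoneOn (fun T => integratedForm U' V' p' q' T - integratedForm U V p q T)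
      (Set.Ici 0) := by
    have hd : ∀ T : ℝ, 0 ≤ T → HasDerivAt
        (fun T => integratedForm U' V' p' q' T - integratedForm U V p q T) _ T := fun T hT =>
      (hasDerivAt_integratedForm hU' hV' hp' hq' hker' hT).sub
        (hasDerivAt_integratedForm hU hV hp hq hker hT)
    refine antitoneOn_of_deriv_nonpos (convex_Ici 0)
      (fun T hT => (hd T hT).continuousAt.continuousWithinAt)
      (fun T hT => (hd T (interior_subset hT)).differentiableAt.differentiableWithinAt)
      fun T hT => ?_
    rw [interior_Ici, Set.mem_Ioi] at hT
    rw [(hd T hT.le).deriv, sub_nonpos]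
    obtain ⟨Y, hY⟩ := exists_variationalForm_eq hU' hV' T
    obtain ⟨X, hX⟩ := exists_variationalForm_channel_le hK hρ hσ hT.le Y
    rw [← hY]
    exact hX.trans (variationalForm_le hU hV hp hq hker hT X)
  have htr : (∑ j, K j * ρ * (K j)ᴴ).trace = ρ.trace := by
    conv_rhs => rw [← Matrix.mul_one ρ, ← hK, Matrix.mul_sum, trace_sum]
    rw [trace_sum]
    refine Finset.sum_congr rfl fun j _ => ?_
    rw [trace_mul_comm, ← Matrix.mul_assoc, trace_mul_comm]
  have hsum : ∑ j, ∑ i, overlap V' U' j i * p' i = ∑ j, ∑ i, overlap V U j i * p i := by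
    rw [sum_overlap_mul hU'.1 hV'.2.1, sum_overlap_mul hU.1 hV.2.1, hU'.sum_eq_trace,
      hU.sum_eq_trace, htr]
  refine le_of_tendsto_of_tendsto (tendsto_integratedForm hU' hV' hp' hq' hker')
    (tendsto_integratedForm hU hV hp hq hker) ?_
  filter_upwards [Filter.eventually_ge_atTop 0] with T hT
  have h := hanti Set.self_mem_Ici hT hT
  simp only [integratedForm, zero_mul, add_zero, sub_self, mul_zero,
    Finset.sum_const_zero] at h
  rw [hsum]
  simp only [integratedForm]
  linarith

lemma Diagonalizes.trace_mul {U V ρ L : Matrix n n ℂ} {p l : n → ℝ}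
    (hρ : Diagonalizes U p ρ) (hL : Diagonalizes V l L) :
    (ρ * L).trace.re = ∑ j, ∑ i, overlap V U j i * (p i * l j) := by
  have h : (ρ * L).trace = (diagonal (fun j => (l j : ℂ)) *
      ((Vᴴ * U) * diagonal (fun i => (p i : ℂ)) * (Vᴴ * U)ᴴ)).trace := by
    rw [hρ.2.2, hL.2.2, ← Matrix.mul_assoc, trace_mul_comm, conjTranspose_mul,
      conjTranspose_conjTranspose, trace_mul_comm (diagonal fun j => (l j : ℂ))]
    simp only [Matrix.mul_assoc]
  rw [h]
  simp only [trace, diag_apply, diagonal_mul, mul_apply (M := _ * diagonal _), mul_diagonal,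
    Finset.mul_sum, Complex.re_sum]
  refine Finset.sum_congr rfl fun j _ => Finset.sum_congr rfl fun i _ => ?_
  simp [overlap, conjTranspose_apply, Complex.normSq_apply]
  ring

/-- A function of a diagonalized matrix commutes with everything the matrix commutes with. -/
lemma Diagonalizes.commute_map {V σ G : Matrix n n ℂ} {q : n → ℝ} (hσ : Diagonalizes V q σ)
    (hG : Commute G σ) (f : ℝ → ℝ) :
    Commute G (V * diagonal (fun i => (f (q i) : ℂ)) * Vᴴ) := by
  obtain ⟨hV, hV', rfl⟩ := hσ
  set H := Vᴴ * G * V with hH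
  have hGV : G = V * H * Vᴴ := by
    rw [hH, show V * (Vᴴ * G * V) * Vᴴ = (V * Vᴴ) * G * (V * Vᴴ) by
      simp only [Matrix.mul_assoc], hV', Matrix.one_mul, Matrix.mul_one]
  have hconj : ∀ A B : Matrix n n ℂ, V * A * Vᴴ * (V * B * Vᴴ) = V * (A * B) * Vᴴ := by
    intro A B
    rw [show V * A * Vᴴ * (V * B * Vᴴ) = V * A * (Vᴴ * V) * B * Vᴴ by
      simp only [Matrix.mul_assoc], hV]
    simp only [Matrix.mul_assoc, Matrix.one_mul]
  have hcancel : ∀ A : Matrix n n ℂ, Vᴴ * (V * A * Vᴴ) * V = A := by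
    intro A
    rw [show Vᴴ * (V * A * Vᴴ) * V = (Vᴴ * V) * A * (Vᴴ * V) by
      simp only [Matrix.mul_assoc], hV, Matrix.one_mul, Matrix.mul_one]
  have hc : H * diagonal (fun i => (q i : ℂ)) = diagonal (fun i => (q i : ℂ)) * H := by
    have h := hG.eq
    rw [hGV, hconj, hconj] at h
    rw [← hcancel (H * _), h, hcancel]
  rw [commute_iff_eq, hGV, hconj, hconj]
  congr 2
  ext i j
  have hij := congrFun (congrFun hc i) j
  rw [mul_diagonal, diagonal_mul] at hij ⊢
  rcases eq_or_ne (q i) (q j) with h | h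
  · rw [h, mul_comm]
  · have : H i j = 0 := by
      have h0 : ((q i : ℂ) - q j) * H i j = 0 := by linear_combination -hij
      refine (mul_eq_zero.1 h0).resolve_left (sub_ne_zero.2 ?_)
      exact_mod_cast h
    rw [this, zero_mul, mul_zero]

lemma vN_eq_sum {ρ : Matrix n n ℂ} (h : ρ.IsHermitian) :
    vN ρ = ∑ i, Real.negMulLog (h.eigenvalues i) := by
  rw [vN, dif_pos h]

end RelativeEntropy

section Dephasing

variable {nA nB : Type*} [DecidableEq nA] [DecidableEq nB]

/-- The projection onto the `a`-th basis vector of `A`, acting on the bipartite space. -/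
noncomputable def projA (nB : Type*) [DecidableEq nB] (a : nA) :
    Matrix (nA × nB) (nA × nB) ℂ :=
  diagonal (Pi.single a 1) ⊗ₖ 1

lemma projA_eq_diagonal (a : nA) :
    projA nB a = diagonal fun x : nA × nB => if x.1 = a then (1 : ℂ) else 0 := by
  rw [projA, ← diagonal_one, diagonal_kronecker_diagonal]
  congr 1
  ext x
  simp [Pi.single_apply]

lemma projA_conjTranspose (a : nA) : (projA nB a)ᴴ = projA nB a := by
  rw [projA_eq_diagonal, diagonal_conjTranspose]
  congr 1
  ext x
  simp [apply_ite]

variable [Fintype nA]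

lemma sum_projA : ∑ a : nA, projA nB a = 1 := by
  ext x y
  simp [projA_eq_diagonal, Matrix.sum_apply, diagonal_apply, one_apply, Finset.sum_ite_irrel]

variable [Fintype nB]

lemma dephA_eq_sum (ρ : Matrix (nA × nB) (nA × nB) ℂ) :
    dephA ρ = ∑ a, projA nB a * ρ * projA nB a := by
  ext x y
  simp only [dephA, of_apply, Matrix.sum_apply, projA_eq_diagonal, mul_diagonal, diagonal_mul]
  simp [eq_comm]

lemma projA_mul_projA (a a' : nA) :
    projA nB a * projA nB a' = if a = a' then projA nB a else 0 := by
  simp only [projA_eq_diagonal, diagonal_mul_diagonal]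
  split_ifs with h
  · subst h; simp
  · rw [← diagonal_zero]
    congr 1
    ext x
    by_cases hx : x.1 = a
    · simp [hx, h]
    · simp [hx]

lemma commute_projA_dephA (ρ : Matrix (nA × nB) (nA × nB) ℂ) (a : nA) :
    Commute (projA nB a) (dephA ρ) := by
  rw [commute_iff_eq, dephA_eq_sum, Matrix.mul_sum, Matrix.sum_mul]
  refine Finset.sum_congr rfl fun b _ => ?_
  rw [← Matrix.mul_assoc, ← Matrix.mul_assoc, projA_mul_projA, Matrix.mul_assoc _ _ (projA nB a),
    projA_mul_projA]
  rcases eq_or_ne a b with rfl | h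
  · simp
  · simp [h, h.symm]

lemma posSemidef_dephA {ρ : Matrix (nA × nB) (nA × nB) ℂ} (hρ : ρ.PosSemidef) :
    (dephA ρ).PosSemidef := by
  rw [dephA_eq_sum]
  refine posSemidef_sum _ fun a _ => ?_
  simpa only [projA_conjTranspose] using hρ.mul_mul_conjTranspose_same (projA nB a)

lemma mulVec_eq_zero_of_dephA {ρ : Matrix (nA × nB) (nA × nB) ℂ} (hρ : ρ.PosSemidef)
    (x : nA × nB → ℂ) (hx : dephA ρ *ᵥ x = 0) : ρ *ᵥ x = 0 := by
  have h : ∑ a, star (projA nB a *ᵥ x) ⬝ᵥ ρ *ᵥ (projA nB a *ᵥ x) = 0 := by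
    have h0 : star x ⬝ᵥ dephA ρ *ᵥ x = 0 := by rw [hx, dotProduct_zero]
    rw [← h0, dephA_eq_sum, sum_mulVec, dotProduct_sum]
    refine Finset.sum_congr rfl fun a _ => ?_
    rw [star_mulVec, projA_conjTranspose, ← dotProduct_mulVec, mulVec_mulVec, mulVec_mulVec,
      Matrix.mul_assoc]
  rw [Finset.sum_eq_zero_iff_of_nonneg fun a _ => hρ.dotProduct_mulVec_nonneg _] at h
  rw [← one_mulVec x, ← sum_projA, sum_mulVec, mulVec_sum]
  exact Finset.sum_eq_zero fun a ha => (hρ.dotProduct_mulVec_zero_iff _).1 (h a ha)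

lemma trace_dephA_mul {ρ L : Matrix (nA × nB) (nA × nB) ℂ}
    (hL : ∀ a, Commute (projA nB a) L) : (dephA ρ * L).trace = (ρ * L).trace := by
  have h : ∀ a, (projA nB a * ρ * projA nB a * L).trace = (ρ * L * projA nB a).trace := by
    intro a
    rw [Matrix.mul_assoc, (hL a).eq, Matrix.mul_assoc, trace_mul_comm]
    simp only [Matrix.mul_assoc, projA_mul_projA, if_true]
  rw [dephA_eq_sum, Matrix.sum_mul, trace_sum, Finset.sum_congr rfl fun a _ => h a, ← trace_sum,
    ← Matrix.mul_sum, sum_projA, Matrix.mul_one]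

/-- The quantum-incoherent relative entropy is the relative entropy to the dephased state. -/
lemma vN_dephA_sub_vN {ρ : Matrix (nA × nB) (nA × nB) ℂ} (hρ : ρ.IsHermitian)
    (hσ : (dephA ρ).IsHermitian) :
    vN (dephA ρ) - vN ρ = ∑ j, ∑ i,
      overlap (hσ.eigenvectorUnitary : Matrix _ _ ℂ) (hρ.eigenvectorUnitary : Matrix _ _ ℂ) j i *
        (hρ.eigenvalues i * (Real.log (hρ.eigenvalues i) - Real.log (hσ.eigenvalues j))) := by
  have hU := hρ.diagonalizes
  have hV := hσ.diagonalizes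
  set V := (hσ.eigenvectorUnitary : Matrix (nA × nB) (nA × nB) ℂ)
  set U := (hρ.eigenvectorUnitary : Matrix (nA × nB) (nA × nB) ℂ)
  have hL : Diagonalizes V (fun j => Real.log (hσ.eigenvalues j))
      (V * diagonal (fun j => (Real.log (hσ.eigenvalues j) : ℂ)) * Vᴴ) := ⟨hV.1, hV.2.1, rfl⟩
  have hcross := congrArg Complex.re
    (trace_dephA_mul (ρ := ρ) fun a => hV.commute_map (commute_projA_dephA ρ a) Real.log)
  rw [hU.trace_mul hL, hV.trace_mul hL] at hcross
  have hself : ∑ j, ∑ i, overlap V V j i *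
      (hσ.eigenvalues i * Real.log (hσ.eigenvalues j)) = -vN (dephA ρ) := by
    rw [vN_eq_sum hσ, ← Finset.sum_neg_distrib]
    refine Finset.sum_congr rfl fun j _ => ?_
    simp only [overlap, hV.1, one_apply]
    simp [apply_ite, Real.negMulLog]
  simp only [mul_sub, Finset.sum_sub_distrib]
  rw [sum_overlap_mul hU.1 hV.2.1 fun i => hρ.eigenvalues i * Real.log (hρ.eigenvalues i),
    ← hcross, hself, vN_eq_sum hρ]
  simp only [Real.negMulLog, neg_mul, Finset.sum_neg_distrib]
  ring

lemma dephA_channel {ι : Type*} [Fintype ι] (M : ι → Matrix nB nB ℂ)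
    (ρ : Matrix (nA × nB) (nA × nB) ℂ) :
    dephA (∑ j, ((1 : Matrix nA nA ℂ) ⊗ₖ M j) * ρ * ((1 : Matrix nA nA ℂ) ⊗ₖ M j)ᴴ)
      = ∑ j, ((1 : Matrix nA nA ℂ) ⊗ₖ M j) * dephA ρ * ((1 : Matrix nA nA ℂ) ⊗ₖ M j)ᴴ := by
  have hcomm : ∀ (a : nA) (B : Matrix nB nB ℂ),
      projA nB a * ((1 : Matrix nA nA ℂ) ⊗ₖ B) = ((1 : Matrix nA nA ℂ) ⊗ₖ B) * projA nB a := by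
    intro a B
    rw [projA, ← mul_kronecker_mul, ← mul_kronecker_mul]
    simp only [Matrix.mul_one, Matrix.one_mul]
  simp only [dephA_eq_sum, conjTranspose_kronecker, conjTranspose_one, Matrix.mul_sum,
    Matrix.sum_mul]
  rw [Finset.sum_comm]
  refine Finset.sum_congr rfl fun j _ => Finset.sum_congr rfl fun a _ => ?_
  rw [← Matrix.mul_assoc, ← Matrix.mul_assoc, hcomm]
  simp only [Matrix.mul_assoc, hcomm]

end Dephasing

/-- Monotonicity of the quantum-incoherent relative entropy under a quantum
channel acting only on `B`: `C^{A|B}(Λ(ρ)) ≤ C^{A|B}(ρ)`. -/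
theorem qi_coherence_mono_under_channel_on_B
    {nA nB : Type*} [Fintype nA] [DecidableEq nA] [Nonempty nA]
    [Fintype nB] [DecidableEq nB] [Nonempty nB]
    {ι : Type*} [Fintype ι]
    (M : ι → Matrix nB nB ℂ) (hM : ∑ j, (M j)ᴴ * M j = 1)
    (ρ : Matrix (nA × nB) (nA × nB) ℂ) (hρ : ρ.PosSemidef) (htr : ρ.trace = 1) :
    let Λρ : Matrix (nA × nB) (nA × nB) ℂ :=
      ∑ j, ((1 : Matrix nA nA ℂ) ⊗ₖ M j) * ρ * ((1 : Matrix nA nA ℂ) ⊗ₖ M j)ᴴ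
    vN (dephA Λρ) - vN Λρ ≤ vN (dephA ρ) - vN ρ := by
  intro Λρ
  have hK : ∑ j, ((1 : Matrix nA nA ℂ) ⊗ₖ M j)ᴴ * ((1 : Matrix nA nA ℂ) ⊗ₖ M j) = 1 := by
    simp only [conjTranspose_kronecker, conjTranspose_one, ← mul_kronecker_mul, Matrix.mul_one]
    rw [← one_kronecker_one, ← hM]
    ext x y
    simp [Matrix.sum_apply, Finset.mul_sum]
  have hΛ : Λρ.PosSemidef := posSemidef_sum _ fun j _ => hρ.mul_mul_conjTranspose_same _
  have hσ := posSemidef_dephA hρ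
  have hΛσ := posSemidef_dephA hΛ
  have hcomm : dephA Λρ = _ := dephA_channel M ρ
  rw [vN_dephA_sub_vN hΛ.isHermitian hΛσ.isHermitian, vN_dephA_sub_vN hρ.isHermitian hσ.isHermitian]
  exact relativeEntropy_channel_le hK hρ hσ (mulVec_eq_zero_of_dephA hρ)
    (fun x hx => mulVec_eq_zero_of_dephA hΛ x (by rwa [hcomm]))
    hρ.isHermitian.diagonalizes hσ.isHermitian.diagonalizes hΛ.isHermitian.diagonalizes
    (hcomm ▸ hΛσ.isHermitian.diagonalizes) hρ.eigenvalues_nonneg hσ.eigenvalues_nonneg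
    hΛ.eigenvalues_nonneg hΛσ.eigenvalues_nonneg
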